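/- There exist a finite sequence of positive braid moves carrying S_upper to a matrix S′ and a diagonal matrix D with all diagonal entries in {1, −1} such that D·S′·D = C_k. In particular, the Stokes matrix of the quantum cohomology of CP^{k−1} is equivalent, under the braid group action together with permutations and sign changes, to the Gram matrix (binom(k, j−i)) of the Euler bilinear form on a full exceptional collection in the derived category of coherent sheaves on CP^{k−1}. -/

import Mathlib

open Matrix Complex

/-- The matrix `T_F`: `(T_F)_{1,k} = 1`, `(T_F)_{j+1,j} = -1`, all other entries `0`
(1-based indexing). -/
def TFmat (k : ℕ) : Matrix (Fin k) (Fin k) ℂ :=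
  Matrix.of fun i j => if i.val = 0 ∧ j.val = k - 1 then 1
    else if i.val = j.val + 1 then -1 else 0

/-- The Stokes factor `K_{k2}`: identity except `(K_{k2})_{j,k+2-j} = C(k, 2(j-1))`
for `2 ≤ j`, `2j ≤ k+1` (1-based indexing). -/
def Kk2mat (k : ℕ) : Matrix (Fin k) (Fin k) ℂ :=
  Matrix.of fun i j =>
    if 2 ≤ i.val + 1 ∧ 2 * (i.val + 1) ≤ k + 1 ∧ (j.val + 1) + (i.val + 1) = k + 2 then
      (k.choose (2 * i.val) : ℂ)
    else if i = j then 1 else 0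

/-- The Stokes factor `K_{k3}`: identity except `(K_{k3})_{2,1} = -k` and
`(K_{k3})_{j,k+3-j} = C(k, 2j-3)` for `3 ≤ j`, `2j ≤ k+2` (1-based indexing). -/
def Kk3mat (k : ℕ) : Matrix (Fin k) (Fin k) ℂ :=
  Matrix.of fun i j =>
    if i.val + 1 = 2 ∧ j.val + 1 = 1 then -(k : ℂ)
    else if 3 ≤ i.val + 1 ∧ 2 * (i.val + 1) ≤ k + 2 ∧ (j.val + 1) + (i.val + 1) = k + 3 then
      (k.choose (2 * (i.val + 1) - 3) : ℂ)
    else if i = j then 1 else 0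

/-- `T := (T_F⁻¹ · K_{k3} · K_{k2})⁻¹`. -/
noncomputable def Tmonodromy (k : ℕ) : Matrix (Fin k) (Fin k) ℂ :=
  ((TFmat k)⁻¹ * Kk3mat k * Kk2mat k)⁻¹

/-- The Stokes matrix of the quantum cohomology of `CP^{k-1}`:
`S = T_F^{k/2} · T^{-(k/2)}` for `k` even, `S = T_F^{(k-1)/2} · K_{k2} · T^{-((k-1)/2)}`
for `k` odd. -/
noncomputable def Smat (k : ℕ) : Matrix (Fin k) (Fin k) ℂ :=
  if k % 2 = 0 then (TFmat k) ^ (k / 2) * ((Tmonodromy k)⁻¹) ^ (k / 2)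
  else (TFmat k) ^ ((k - 1) / 2) * Kk2mat k * ((Tmonodromy k)⁻¹) ^ ((k - 1) / 2)

/-- The matrix `A` of the positive braid move at (0-based) position `p`, `p+1`. -/
def braidAmat (k p : ℕ) (hp : p + 1 < k) (M : Matrix (Fin k) (Fin k) ℂ) :
    Matrix (Fin k) (Fin k) ℂ :=
  Matrix.of fun n m =>
    if n.val = p ∧ m.val = p + 1 then 1
    else if n.val = p + 1 ∧ m.val = p then 1
    else if n.val = p + 1 ∧ m.val = p + 1 then -(M ⟨p, Nat.lt_of_succ_lt hp⟩ ⟨p + 1, hp⟩)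
    else if n = m ∧ n.val ≠ p ∧ n.val ≠ p + 1 then 1 else 0

/-- One positive braid move: `M ↦ A·M·Aᵀ`. -/
def posBraidMove (k : ℕ) (M M' : Matrix (Fin k) (Fin k) ℂ) : Prop :=
  ∃ p, ∃ hp : p + 1 < k, M' = braidAmat k p hp M * M * (braidAmat k p hp M)ᵀ

/-- The canonical form `C_k`, `(C_k)_{ij} = C(k, j-i)` for `i ≤ j`, `0` below the diagonal:
the Gram matrix of the Euler form on the full exceptional collection
`O, O(1), …, O(k-1)` on `CP^{k-1}`. -/
def Ckmat (k : ℕ) : Matrix (Fin k) (Fin k) ℂ :=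
  Matrix.of fun i j => if i.val ≤ j.val then (k.choose (j.val - i.val) : ℂ) else 0

open Finset Polynomial in
/-- The polynomial `n ↦ binom(n + k - 1, k - 1)`. -/
noncomputable def hilbertPoly (k : ℕ) : Polynomial ℂ :=
  C (((k - 1).factorial : ℂ)⁻¹) * ∏ i ∈ range (k - 1), (X + C ((i : ℂ) + 1))

/-- The Euler characteristic `χ(CP^{k-1}, O(n))`. -/
noncomputable def eulerChar (k : ℕ) (n : ℤ) : ℂ := (hilbertPoly k).eval (n : ℂ)

lemma eulerChar_zero (k : ℕ) : eulerChar k 0 = 1 := by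
  have h : (∏ i ∈ Finset.range (k - 1), ((i : ℂ) + 1)) = ((k - 1).factorial : ℂ) := by
    rw [← Finset.prod_range_add_one_eq_factorial]; push_cast; rfl
  simp [eulerChar, hilbertPoly, Polynomial.eval_prod, h, Nat.factorial_ne_zero]

lemma eulerChar_eq_zero (k : ℕ) (n : ℤ) (h1 : n < 0) (h2 : -(k : ℤ) < n) :
    eulerChar k n = 0 := by
  obtain ⟨j, rfl⟩ : ∃ j : ℕ, n = -((j : ℤ) + 1) := ⟨(-n - 1).toNat, by omega⟩
  simp only [eulerChar, hilbertPoly, Polynomial.eval_mul, Polynomial.eval_prod]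
  rw [Finset.prod_eq_zero (i := j) (by simp; omega) (by simp), mul_zero]

/-- The Koszul relation: `k`-th differences of the Hilbert polynomial vanish. -/
lemma sum_choose_mul_eulerChar (k : ℕ) (hk : 0 < k) (n : ℤ) :
    ∑ i ∈ Finset.range (k + 1), (-1) ^ i * (k.choose i : ℂ) * eulerChar k (n + i) = 0 := by
  have hdeg : (hilbertPoly k).natDegree < k := by
    refine lt_of_le_of_lt (Polynomial.natDegree_C_mul_le _ _) ?_
    refine lt_of_le_of_lt (Polynomial.natDegree_prod_le _ _) ?_
    refine lt_of_le_of_lt (Finset.sum_le_card_nsmul _ _ 1 fun i _ => ?_) ?_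
    · exact (Polynomial.natDegree_X_add_C _).le
    · simp; omega
  have h := congrFun (Polynomial.fwdDiff_iter_eq_zero_of_degree_lt hdeg) (n : ℂ)
  rw [fwdDiff_iter_eq_sum_shift] at h
  have h2 := congrArg (fun z => (-1 : ℂ) ^ k * z) h
  simp only [Pi.zero_apply, mul_zero, Finset.mul_sum] at h2
  rw [← h2]
  refine Finset.sum_congr rfl fun i hi => ?_
  have hi' : i ≤ k := by simpa [Nat.lt_succ_iff] using hi
  have hs : (-1 : ℂ) ^ k * (-1) ^ (k - i) = (-1) ^ i := by
    obtain ⟨d, rfl⟩ := Nat.exists_eq_add_of_le hi'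
    rw [Nat.add_sub_cancel_left, pow_add, mul_assoc, ← mul_pow]; simp
  simp only [eulerChar, zsmul_eq_mul, nsmul_eq_mul, mul_one]
  push_cast
  rw [← hs]; ring

/-- The Euler form on the free module on the classes of the `O(n)`, `n ∈ ℤ`. -/
noncomputable def eulerForm (k : ℕ) : (ℤ →₀ ℂ) →ₗ[ℂ] (ℤ →₀ ℂ) →ₗ[ℂ] ℂ :=
  Finsupp.linearCombination ℂ fun a : ℤ =>
    Finsupp.linearCombination ℂ fun b : ℤ => eulerChar k (b - a)

/-- The class of `O(n)`. -/
noncomputable def lineBundle (n : ℤ) : ℤ →₀ ℂ := Finsupp.single n 1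

/-- The truncated Koszul complex on `O(a), …, O(a + d)`, i.e. the right mutation of `O(a)` over
`O(a + 1), …, O(a + d)`. -/
noncomputable def koszul (k : ℕ) (a : ℤ) (d : ℕ) : ℤ →₀ ℂ :=
  ∑ i ∈ Finset.range (d + 1), ((-1) ^ i * (k.choose i : ℂ)) • lineBundle (a + i)

/-- Tensoring with `O(n)`. -/
noncomputable def twist (n : ℤ) : (ℤ →₀ ℂ) →ₗ[ℂ] (ℤ →₀ ℂ) :=
  Finsupp.lmapDomain ℂ ℂ (· + n)

@[simp] lemma eulerForm_lineBundle (k : ℕ) (a b : ℤ) :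
    eulerForm k (lineBundle a) (lineBundle b) = eulerChar k (b - a) := by
  simp [eulerForm, lineBundle]

@[simp] lemma twist_lineBundle (n a : ℤ) : twist n (lineBundle a) = lineBundle (a + n) := by
  simp [twist, lineBundle]

lemma eulerForm_twist (k : ℕ) (n : ℤ) (x y : ℤ →₀ ℂ) :
    eulerForm k (twist n x) (twist n y) = eulerForm k x y := by
  have h : (eulerForm k).compl₁₂ (twist n) (twist n) = eulerForm k := by
    ext a b
    have := eulerForm_lineBundle k (a + n) (b + n)
    rw [← twist_lineBundle, ← twist_lineBundle] at this
    have h2 := eulerForm_lineBundle k a b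
    simp only [lineBundle, add_sub_add_right_eq_sub] at this h2
    simpa [← h2] using this
  exact congrArg (fun B => B x y) h

@[simp] lemma koszul_zero (k : ℕ) (a : ℤ) : koszul k a 0 = lineBundle a := by
  simp [koszul]

lemma koszul_succ (k : ℕ) (a : ℤ) (d : ℕ) : koszul k a (d + 1) =
    koszul k a d + ((-1) ^ (d + 1) * (k.choose (d + 1) : ℂ)) • lineBundle (a + (d + 1 : ℕ)) := by
  rw [koszul, Finset.sum_range_succ, ← koszul]

@[simp] lemma twist_koszul (k : ℕ) (n a : ℤ) (d : ℕ) :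
    twist n (koszul k a d) = koszul k (a + n) d := by
  simp only [koszul, map_sum, map_smul, twist_lineBundle, add_right_comm]

lemma eulerForm_koszul_right (k : ℕ) (hk : 0 < k) (a : ℤ) (y : ℤ →₀ ℂ) :
    eulerForm k y (koszul k a k) = 0 := by
  have h : (eulerForm k).flip (koszul k a k) = 0 := by
    ext b
    have : eulerForm k (lineBundle b) (koszul k a k) = 0 := by
      simp only [koszul, map_sum, map_smul, eulerForm_lineBundle, smul_eq_mul]
      rw [← sum_choose_mul_eulerChar k hk (a - b)]
      exact Finset.sum_congr rfl fun i _ => by rw [add_sub_right_comm]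
    simpa [lineBundle] using this
  exact congrArg (fun B => B y) h

/-- `⟨koszul a d, O(c)⟩ = δ_{a,c}` for `c` in a window of length `k` ending at `a + d`. -/
lemma eulerForm_koszul_lineBundle (k : ℕ) (a c : ℤ) (d : ℕ) (hd : d < k)
    (h1 : a + d - k < c) (h2 : c ≤ a + d) :
    eulerForm k (koszul k a d) (lineBundle c) = if c = a then 1 else 0 := by
  simp only [koszul, map_sum, map_smul, LinearMap.sum_apply, LinearMap.smul_apply,
    eulerForm_lineBundle, smul_eq_mul]
  have hk : 0 < k := by omega
  split_ifs with hca
  · subst hca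
    rw [Finset.sum_range_succ', Finset.sum_eq_zero]
    · simp [eulerChar_zero]
    · intro i hi
      have := Finset.mem_range.1 hi
      rw [eulerChar_eq_zero k _ (by push_cast; omega) (by push_cast; omega), mul_zero]
  · rcases lt_or_ge c a with h | h
    · refine Finset.sum_eq_zero fun i hi => ?_
      have := Finset.mem_range.1 hi
      rw [eulerChar_eq_zero k _ (by omega) (by omega), mul_zero]
    · have hz := sum_choose_mul_eulerChar k hk (c - a - k)
      rw [← Finset.sum_range_reflect] at hz
      have hsub : Finset.range (d + 1) ⊆ Finset.range (k + 1) :=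
        Finset.range_subset_range.2 (by omega)
      have hz2 : ∑ i ∈ Finset.range (k + 1),
          (-1) ^ i * (k.choose i : ℂ) * eulerChar k (c - (a + i)) = 0 := by
        rw [← mul_zero ((-1 : ℂ) ^ k), ← hz, Finset.mul_sum]
        refine Finset.sum_congr rfl fun i hi => ?_
        have hi' : i ≤ k := by simpa [Nat.lt_succ_iff] using hi
        obtain ⟨e, he⟩ := Nat.exists_eq_add_of_le hi'
        have e1 : k + 1 - 1 - i = e := by omega
        have e2 : k.choose e = k.choose i := by
          rw [he, Nat.choose_symm_add]
        have e3 : c - a - k + (e : ℤ) = c - (a + i) := by omega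
        rw [e1, e2, e3]
        have e4 : (-1 : ℂ) ^ k * (-1) ^ e = (-1) ^ i := by
          rw [he, pow_add, mul_assoc, ← mul_pow]; simp
        rw [← e4]; ring
      rw [← hz2]
      refine Finset.sum_subset hsub fun i hi hi' => ?_
      simp only [Finset.mem_range] at hi hi'
      rw [eulerChar_eq_zero k _ (by omega) (by omega), mul_zero]
lemma eulerForm_koszul_next (k : ℕ) (a : ℤ) (d : ℕ) (hd : d + 1 < k) :
    eulerForm k (koszul k a d) (lineBundle (a + (d + 1 : ℕ))) =
      -((-1) ^ (d + 1) * (k.choose (d + 1) : ℂ)) := by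
  have h := eulerForm_koszul_lineBundle k a (a + (d + 1 : ℕ)) (d + 1) hd (by omega) (by omega)
  rw [if_neg (by omega), koszul_succ] at h
  simp only [map_add, map_smul, LinearMap.add_apply, LinearMap.smul_apply, eulerForm_lineBundle,
    sub_self, eulerChar_zero, smul_eq_mul, mul_one] at h
  exact eq_neg_of_add_eq_zero_left h

/-- `M` is the Gram matrix of the Euler form on a collection of classes which are, up to sign,
the truncated Koszul complexes listed in `l`. -/
def Realizes (k : ℕ) (l : List (ℤ × ℕ)) (M : Matrix (Fin k) (Fin k) ℂ) : Prop :=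
  ∃ v : Fin k → (ℤ →₀ ℂ), (∀ i j, M i j = eulerForm k (v i) (v j)) ∧
    ∀ i : Fin k, ∃ x : ℤ × ℕ, l[i.val]? = some x ∧
      ∃ s : ℂ, (s = 1 ∨ s = -1) ∧ v i = s • koszul k x.1 x.2

/-- A mutation of a truncated Koszul complex over the next line bundle. -/
def MutationStep (k : ℕ) (l l' : List (ℤ × ℕ)) : Prop :=
  ∃ (l₁ l₂ : List (ℤ × ℕ)) (a : ℤ) (d : ℕ), d + 1 < k ∧
    l = l₁ ++ (a, d) :: (a + (d + 1 : ℕ), 0) :: l₂ ∧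
    l' = l₁ ++ (a + (d + 1 : ℕ), 0) :: (a, d + 1) :: l₂

/-- The rows of the braid matrix. -/
lemma sum_braidAmat_smul {V : Type*} [AddCommGroup V] [Module ℂ V] (k p : ℕ) (hp : p + 1 < k)
    (M : Matrix (Fin k) (Fin k) ℂ) (v : Fin k → V) (n : Fin k) :
    ∑ m, braidAmat k p hp M n m • v m =
      if n.val = p then v ⟨p + 1, hp⟩
      else if n.val = p + 1 then
        v ⟨p, Nat.lt_of_succ_lt hp⟩ -
          M ⟨p, Nat.lt_of_succ_lt hp⟩ ⟨p + 1, hp⟩ • v ⟨p + 1, hp⟩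
      else v n := by
  have hne : (⟨p, Nat.lt_of_succ_lt hp⟩ : Fin k) ≠ ⟨p + 1, hp⟩ := by simp
  split_ifs with h1 h2
  · rw [Finset.sum_eq_single ⟨p + 1, hp⟩]
    · simp [braidAmat, h1]
    · intro m _ hm
      have : m.val ≠ p + 1 := fun h => hm (Fin.ext h)
      simp [braidAmat, h1, this]
    · simp
  · rw [Finset.sum_eq_add _ _ hne]
    · simp [braidAmat, h2, sub_eq_add_neg]
    · intro m _ hm
      have e1 : m.val ≠ p + 1 := fun h => hm.2 (Fin.ext h)
      have e2 : m.val ≠ p := fun h => hm.1 (Fin.ext h)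
      simp [braidAmat, h2, e1, e2]
    · simp
    · simp
  · rw [Finset.sum_eq_single n]
    · simp [braidAmat, h1, h2]
    · intro m _ hm
      simp [braidAmat, h1, h2, hm.symm]
    · simp

lemma gram_congr {V : Type*} [AddCommGroup V] [Module ℂ V] (k : ℕ)
    (B : V →ₗ[ℂ] V →ₗ[ℂ] ℂ) (M A : Matrix (Fin k) (Fin k) ℂ) (v : Fin k → V)
    (hM : ∀ i j, M i j = B (v i) (v j)) (i j : Fin k) :
    (A * M * Aᵀ) i j = B (∑ m, A i m • v m) (∑ m, A j m • v m) := by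
  simp only [Matrix.mul_apply, Matrix.transpose_apply, map_sum, map_smul, LinearMap.sum_apply,
    LinearMap.smul_apply, smul_eq_mul, hM, Finset.sum_mul, Finset.mul_sum]
  exact Finset.sum_congr rfl fun x _ => Finset.sum_congr rfl fun y _ => by ring

lemma Realizes.step {k : ℕ} {l l' : List (ℤ × ℕ)} {M : Matrix (Fin k) (Fin k) ℂ}
    (hl : l.length = k) (hM : Realizes k l M) (h : MutationStep k l l') :
    ∃ M', posBraidMove k M M' ∧ Realizes k l' M' := by
  obtain ⟨l₁, l₂, a, d, hd, rfl, rfl⟩ := h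
  obtain ⟨v, hv, hx⟩ := hM
  have hp : l₁.length + 1 < k := by simp at hl; omega
  refine ⟨_, ⟨l₁.length, hp, rfl⟩,
    fun n => ∑ m, braidAmat k l₁.length hp M n m • v m, gram_congr k _ _ _ _ hv, fun i => ?_⟩
  obtain ⟨x₁, hx₁, s₁, hs₁, hv₁⟩ := hx ⟨l₁.length, by omega⟩
  obtain ⟨x₂, hx₂, s₂, hs₂, hv₂⟩ := hx ⟨l₁.length + 1, hp⟩
  rw [List.getElem?_append_right (by simp)] at hx₁ hx₂
  simp at hx₁ hx₂
  subst hx₁ hx₂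
  simp only [sum_braidAmat_smul]
  split_ifs with h1 h2
  · refine ⟨(a + (d + 1 : ℕ), 0), by simp [h1], s₂, hs₂, by simpa using hv₂⟩
  · refine ⟨(a, d + 1), ?_, s₁, hs₁, ?_⟩
    · rw [List.getElem?_append_right (by omega)]; simp [h2]
    · have hn := eulerForm_koszul_next k a d hd
      rw [hv, hv₁, hv₂]
      simp only [koszul_zero, map_smul, LinearMap.smul_apply, smul_eq_mul]
      push_cast at hn ⊢
      rw [hn, koszul_succ, smul_smul, smul_add, smul_smul, sub_eq_add_neg, ← neg_smul]
      have hs : s₂ * s₂ = 1 := by rcases hs₂ with rfl | rfl <;> norm_num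
      congr 2
      linear_combination (s₁ * ((-1) ^ (d + 1) * (k.choose (d + 1) : ℂ))) * hs
  · obtain ⟨x, hx', hs⟩ := hx i
    refine ⟨x, ?_, hs⟩
    rcases lt_or_ge i.val l₁.length with h | h
    · rw [List.getElem?_append_left h] at hx' ⊢; exact hx'
    · rw [List.getElem?_append_right h] at hx' ⊢
      obtain ⟨e, he⟩ : ∃ e, i.val - l₁.length = e + 2 := ⟨i.val - l₁.length - 2, by omega⟩
      rw [he] at hx' ⊢
      simpa using hx'

lemma MutationStep.length_eq {k : ℕ} {l l' : List (ℤ × ℕ)} (h : MutationStep k l l') :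
    l'.length = l.length := by
  obtain ⟨l₁, l₂, a, d, -, rfl, rfl⟩ := h
  simp

lemma Realizes.steps {k : ℕ} {l l' : List (ℤ × ℕ)} {M : Matrix (Fin k) (Fin k) ℂ}
    (hl : l.length = k) (hM : Realizes k l M) (h : Relation.ReflTransGen (MutationStep k) l l') :
    ∃ M', Relation.ReflTransGen (posBraidMove k) M M' ∧ Realizes k l' M' := by
  suffices H : l'.length = k ∧
      ∃ M', Relation.ReflTransGen (posBraidMove k) M M' ∧ Realizes k l' M' from H.2
  induction h with
  | refl => exact ⟨hl, M, .refl, hM⟩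
  | tail _ hs ih =>
    obtain ⟨hl', M', hM', hr⟩ := ih
    obtain ⟨M'', hs', hr'⟩ := hr.step hl' hs
    exact ⟨hs.length_eq.trans hl', M'', hM'.tail hs', hr'⟩

/-- The list `O(b), …, O(b + n - 1)`. -/
def lineBundles (b : ℤ) : ℕ → List (ℤ × ℕ)
  | 0 => []
  | n + 1 => (b, 0) :: lineBundles (b + 1) n

/-- Koszul complexes with decreasing starting point and a common end point. -/
def dualCollection (a : ℤ) (d : ℕ) : ℕ → List (ℤ × ℕ)
  | 0 => []
  | n + 1 => (a, d) :: dualCollection (a - 1) (d + 1) n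

/-- Koszul complexes with increasing length around a fixed centre, interlaced with
line bundles. -/
def interlaced (a : ℤ) (d : ℕ) : ℕ → List (ℤ × ℕ)
  | 0 => []
  | n + 1 => (a, d) :: (a + (d + 1 : ℕ), 0) :: interlaced (a - 1) (d + 2) n

lemma dualCollection_append (a : ℤ) (d n n' : ℕ) :
    dualCollection a d n ++ dualCollection (a - n) (d + n) n' = dualCollection a d (n + n') := by
  induction n generalizing a d with
  | zero => simp [dualCollection]
  | succ n ih =>
    rw [Nat.succ_add, dualCollection, dualCollection, ← ih, List.cons_append]
    congr 3
    · push_cast; ring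
    · ring

lemma mutationSteps_append {k : ℕ} {l l' : List (ℤ × ℕ)} (l₁ l₂ : List (ℤ × ℕ))
    (h : Relation.ReflTransGen (MutationStep k) l l') :
    Relation.ReflTransGen (MutationStep k) (l₁ ++ l ++ l₂) (l₁ ++ l' ++ l₂) := by
  refine Relation.ReflTransGen.lift (fun l => l₁ ++ l ++ l₂) ?_ _ _ h
  rintro _ _ ⟨u₁, u₂, a, d, hd, rfl, rfl⟩
  exact ⟨l₁ ++ u₁, u₂ ++ l₂, a, d, hd, by simp, by simp⟩

/-- Right mutation through a block of line bundles. -/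
lemma mutationSteps_block (k : ℕ) (a : ℤ) (d n : ℕ) (h : d + n < k) :
    Relation.ReflTransGen (MutationStep k) ((a, d) :: lineBundles (a + (d + 1 : ℕ)) n)
      (lineBundles (a + (d + 1 : ℕ)) n ++ [(a, d + n)]) := by
  induction n generalizing d with
  | zero => exact .refl
  | succ n ih =>
    have h2 := mutationSteps_append [(a + (d + 1 : ℕ), 0)] [] (ih (d + 1) (by omega))
    have e1 : a + ((d + 1 : ℕ) : ℤ) + 1 = a + ((d + 1 + 1 : ℕ) : ℤ) := by push_cast; ring
    have e2 : d + (n + 1) = d + 1 + n := by ring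
    rw [lineBundles, e1, e2]
    refine .head ⟨[], lineBundles (a + (d + 1 + 1 : ℕ)) n, a, d, by omega, by simp, rfl⟩ ?_
    simpa using h2

lemma mutationSteps_interlaced (k : ℕ) (a : ℤ) (d n : ℕ) (h : d + 2 * n ≤ k) :
    Relation.ReflTransGen (MutationStep k) (interlaced a d n)
      (lineBundles (a + (d + 1 : ℕ)) n ++ dualCollection a (d + n) n) := by
  induction n generalizing a d with
  | zero => exact .refl
  | succ n ih =>
    have h1 := mutationSteps_append [(a, d), (a + (d + 1 : ℕ), 0)] []
      (ih (a - 1) (d + 2) (by omega))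
    have h2 := mutationSteps_append [] (dualCollection (a - 1) (d + 2 + n) n)
      (mutationSteps_block k a d (n + 1) (by omega))
    have e1 : a - 1 + ((d + 2 + 1 : ℕ) : ℤ) = a + ((d + 1 : ℕ) : ℤ) + 1 := by push_cast; ring
    have e2 : d + (n + 1) + 1 = d + 2 + n := by ring
    rw [e1] at h1
    refine Relation.ReflTransGen.trans (b := _) (by simpa [interlaced] using h1) ?_
    simpa [lineBundles, dualCollection, e2] using h2

lemma mutationSteps_lineBundles (k : ℕ) (b : ℤ) (n : ℕ) (h : n ≤ k) :
    Relation.ReflTransGen (MutationStep k) (lineBundles b n) (dualCollection (b + n - 1) 0 n) := by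
  induction n generalizing b with
  | zero => exact .refl
  | succ n ih =>
    have h1 := mutationSteps_block k b 0 n (by omega)
    have h2 := mutationSteps_append [] [(b, n)] (ih (b + 1) (by omega))
    have h3 := dualCollection_append (b + 1 + n - 1) 0 n 1
    have e1 : b + 1 + (n : ℤ) - 1 - n = b := by ring
    have e2 : b + ((n + 1 : ℕ) : ℤ) - 1 = b + 1 + n - 1 := by push_cast; ring
    rw [e1, Nat.zero_add] at h3
    rw [e2, ← h3, lineBundles]
    refine Relation.ReflTransGen.trans (b := _) (by simpa using h1) ?_
    simpa [dualCollection] using h2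

lemma dualCollection_getElem? (a : ℤ) (d n i : ℕ) (h : i < n) :
    (dualCollection a d n)[i]? = some (a - i, d + i) := by
  induction n generalizing a d i with
  | zero => omega
  | succ n ih =>
    cases i with
    | zero => simp [dualCollection]
    | succ i =>
      simp only [dualCollection, List.getElem?_cons_succ]
      rw [ih _ _ _ (by omega)]
      congr 2
      · push_cast; ring
      · ring

lemma interlaced_getElem?_even (a : ℤ) (d n i : ℕ) (h : i < n) :
    (interlaced a d n)[2 * i]? = some (a - i, d + 2 * i) := by
  induction n generalizing a d i with
  | zero => omega
  | succ n ih =>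
    cases i with
    | zero => simp [interlaced]
    | succ i =>
      simp only [interlaced, Nat.mul_succ, List.getElem?_cons_succ]
      rw [ih _ _ _ (by omega)]
      congr 2
      · push_cast; ring
      · ring

lemma interlaced_getElem?_odd (a : ℤ) (d n i : ℕ) (h : i < n) :
    (interlaced a d n)[2 * i + 1]? = some (a + (d + i + 1 : ℕ), 0) := by
  induction n generalizing a d i with
  | zero => omega
  | succ n ih =>
    cases i with
    | zero => simp [interlaced]
    | succ i =>
      have e : 2 * (i + 1) + 1 = (2 * i + 1) + 1 + 1 := by ring
      simp only [interlaced, e, List.getElem?_cons_succ]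
      rw [ih _ _ _ (by omega)]
      congr 2
      push_cast; ring

lemma interlaced_length (a : ℤ) (d n : ℕ) : (interlaced a d n).length = 2 * n := by
  induction n generalizing a d with
  | zero => rfl
  | succ n ih => simp [interlaced, ih]; ring

/-- The Gram matrix of a collection dual to `O(m - k + 1), …, O(m)`. -/
lemma eulerForm_dualCollection (k : ℕ) (m : ℤ) (i j : ℕ) (hi : i < k) (hj : j < k) :
    eulerForm k (koszul k (m - i) i) (koszul k (m - j) j) =
      if i ≤ j then (-1) ^ (j - i) * (k.choose (j - i) : ℂ) else 0 := by
  rw [koszul.eq_def k (m - j) j]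
  simp only [map_sum, map_smul, smul_eq_mul]
  have h : ∀ t ∈ Finset.range (j + 1), (-1) ^ t * (k.choose t : ℂ) *
      eulerForm k (koszul k (m - i) i) (lineBundle (m - j + t)) =
      if t + i = j then (-1) ^ t * (k.choose t : ℂ) else 0 := by
    intro t ht
    have := Finset.mem_range.1 ht
    rw [eulerForm_koszul_lineBundle k _ _ _ hi (by omega) (by omega)]
    by_cases h : t + i = j
    · rw [if_pos h, if_pos (by omega), mul_one]
    · rw [if_neg h, if_neg (by omega), mul_zero]
  rw [Finset.sum_congr rfl h]
  split_ifs with hij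
  · rw [Finset.sum_eq_single (j - i)]
    · rw [if_pos (by omega)]
    · intro t _ ht
      rw [if_neg (by omega)]
    · intro ht
      simp at ht
  · refine Finset.sum_eq_zero fun t _ => if_neg (by omega)

lemma Realizes.exists_diagonal {k : ℕ} {m : ℤ} {M : Matrix (Fin k) (Fin k) ℂ}
    (h : Realizes k (dualCollection m 0 k) M) :
    ∃ d : Fin k → ℂ, (∀ i, d i = 1 ∨ d i = -1) ∧
      Matrix.diagonal d * M * Matrix.diagonal d = Ckmat k := by
  obtain ⟨v, hv, hx⟩ := h
  have hx' : ∀ i : Fin k, ∃ s : ℂ, (s = 1 ∨ s = -1) ∧ v i = s • koszul k (m - i.val) i.val := by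
    intro i
    obtain ⟨x, h1, h2⟩ := hx i
    rw [dualCollection_getElem? _ _ _ _ i.2, Option.some.injEq] at h1
    subst h1
    simpa using h2
  choose s hs hvs using hx'
  refine ⟨fun i => (-1) ^ i.val * s i, fun i => ?_, ?_⟩
  · rcases hs i with h | h <;> rcases neg_one_pow_eq_or ℂ i.val with h' | h' <;> simp [h, h']
  · ext i j
    rw [Matrix.mul_diagonal, Matrix.diagonal_mul, hv, hvs, hvs]
    simp only [map_smul, LinearMap.smul_apply, smul_eq_mul]
    rw [eulerForm_dualCollection k m _ _ i.2 j.2]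
    have e1 : s i * s i = 1 := by rcases hs i with h | h <;> simp [h]
    have e2 : s j * s j = 1 := by rcases hs j with h | h <;> simp [h]
    simp only [Ckmat, Matrix.of_apply]
    split_ifs with hij
    · obtain ⟨t, ht⟩ := Nat.exists_eq_add_of_le hij
      rw [ht, Nat.add_sub_cancel_left]
      have e3 : (-1 : ℂ) ^ i.val * (-1) ^ (i.val + t) * (-1) ^ t = 1 := by
        rw [pow_add, ← mul_assoc, ← mul_pow, mul_assoc, ← mul_pow]; simp
      linear_combination (k.choose t : ℂ) * ((-1 : ℂ) ^ i.val * (-1) ^ (i.val + t) * (-1) ^ t) *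
        (s i * s i * e2 + e1) + (k.choose t : ℂ) * e3
    · simp
@[simp] lemma twist_twist (n n' : ℤ) (x : ℤ →₀ ℂ) : twist n (twist n' x) = twist (n' + n) x := by
  simp only [twist, Finsupp.lmapDomain_apply, ← Finsupp.mapDomain_comp, Function.comp_def,
    add_assoc]

@[simp] lemma twist_zero (x : ℤ →₀ ℂ) : twist 0 x = x := by
  simp only [twist, Finsupp.lmapDomain_apply, add_zero]
  exact Finsupp.mapDomain_id

/-- The classes whose Gram matrix is the Stokes matrix. -/
noncomputable def stokesClass (k l : ℕ) : ℤ →₀ ℂ :=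
  (-1 : ℂ) ^ l • koszul k ((k / 2 : ℕ) - l) (2 * l - k)

/-- The action of `T_F⁻¹ · K_{k3} · K_{k2}` on row vectors. -/
noncomputable def monodromyOp (k : ℕ) (u : ℕ → ℂ) (c : ℕ) : ℂ :=
  if c = 0 then u (k - 1) + k * u 0
  else -u (c - 1) - (if k + 2 ≤ 2 * c then (k.choose (2 * (k + 1 - c) - 1) : ℂ) * u (k - c) else 0)
    - (if k + 1 ≤ 2 * c then (k.choose (2 * (k - c)) : ℂ) * u (k - c - 1) else 0)

lemma TFmat_mul_apply (k : ℕ) (N : Matrix (Fin k) (Fin k) ℂ) (i l : Fin k) :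
    (TFmat k * N) i l = if i.val = 0 then N ⟨k - 1, by have := i.2; omega⟩ l
      else -N ⟨i.val - 1, by have := i.2; omega⟩ l := by
  rw [Matrix.mul_apply]
  split_ifs with h
  · rw [Finset.sum_eq_single ⟨k - 1, by omega⟩]
    · simp [TFmat, h]
    · intro b _ hb
      have : b.val ≠ k - 1 := fun h' => hb (Fin.ext h')
      simp [TFmat, h, this]
    · simp
  · rw [Finset.sum_eq_single ⟨i.val - 1, by omega⟩]
    · have : i.val = i.val - 1 + 1 := by omega
      simp [TFmat, h, ← this]
    · intro b _ hb
      have : i.val ≠ b.val + 1 := fun h' => hb (Fin.ext (by simp; omega))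
      simp [TFmat, h, this]
    · simp

lemma TFmat_mul_transpose (k : ℕ) : TFmat k * (TFmat k)ᵀ = 1 := by
  ext i j
  rw [TFmat_mul_apply, Matrix.one_apply]
  simp only [Matrix.transpose_apply, TFmat, Matrix.of_apply, Fin.ext_iff, and_true]
  split_ifs <;> first | omega | simp

lemma vecMul_TFmat_transpose (k : ℕ) (hk : 2 ≤ k) (u : ℕ → ℂ) :
    (fun i : Fin k => u i) ᵥ* (TFmat k)ᵀ =
      fun c : Fin k => if c.val = 0 then u (k - 1) else -u (c.val - 1) := by
  ext c
  have h := TFmat_mul_apply k (Matrix.of fun i _ => u i) c ⟨0, by omega⟩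
  rw [Matrix.mul_apply] at h
  simp only [Matrix.of_apply] at h
  rw [← h]
  simp [Matrix.vecMul, dotProduct, mul_comm]

lemma vecMul_one_add_single (k : ℕ) (K : Matrix (Fin k) (Fin k) ℂ) (u : ℕ → ℂ) (c : Fin k)
    (q : ℕ) (hq : q < k) (hqc : q ≠ c.val) (z : ℂ) (h1 : K ⟨q, hq⟩ c = z) (h2 : K c c = 1)
    (h3 : ∀ i : Fin k, i ≠ c → i.val ≠ q → K i c = 0) :
    ((fun i : Fin k => u i) ᵥ* K) c = u c + z * u q := by
  rw [Matrix.vecMul, dotProduct, Finset.sum_eq_add c ⟨q, hq⟩]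
  · rw [h1, h2]; ring
  · intro h; apply hqc; rw [h]
  · intro i _ hi
    rw [h3 i hi.1 fun h => hi.2 (Fin.ext h), mul_zero]
  · simp
  · simp

lemma vecMul_of_column_eq_one (k : ℕ) (K : Matrix (Fin k) (Fin k) ℂ) (u : ℕ → ℂ) (c : Fin k)
    (h2 : K c c = 1) (h3 : ∀ i : Fin k, i ≠ c → K i c = 0) :
    ((fun i : Fin k => u i) ᵥ* K) c = u c := by
  rw [Matrix.vecMul, dotProduct, Finset.sum_eq_single c]
  · rw [h2, mul_one]
  · intro i _ hi
    rw [h3 i hi, mul_zero]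
  · simp

lemma vecMul_Kk2mat (k : ℕ) (u : ℕ → ℂ) :
    (fun i : Fin k => u i) ᵥ* Kk2mat k = fun c : Fin k =>
      u c.val + if k + 1 ≤ 2 * c.val then (k.choose (2 * (k - c.val)) : ℂ) * u (k - c.val)
        else 0 := by
  ext c
  split_ifs with h
  · apply vecMul_one_add_single k _ u c (k - c.val) (by omega) (by omega)
    · simp only [Kk2mat, Matrix.of_apply]
      rw [if_pos (by omega)]
    · simp only [Kk2mat, Matrix.of_apply]
      rw [if_neg (by omega), if_pos trivial]
    · intro i h1 h2
      simp only [Kk2mat, Matrix.of_apply]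
      rw [if_neg (by omega), if_neg h1]
  · rw [add_zero]
    apply vecMul_of_column_eq_one
    · simp only [Kk2mat, Matrix.of_apply]
      rw [if_neg (by omega), if_pos trivial]
    · intro i h1
      simp only [Kk2mat, Matrix.of_apply]
      rw [if_neg (by omega), if_neg h1]

lemma vecMul_Kk3mat (k : ℕ) (hk : 3 ≤ k) (u : ℕ → ℂ) :
    (fun i : Fin k => u i) ᵥ* Kk3mat k = fun c : Fin k =>
      u c.val + if c.val = 0 then -(k : ℂ) * u 1
        else if k + 2 ≤ 2 * c.val then
          (k.choose (2 * (k + 1 - c.val) - 1) : ℂ) * u (k + 1 - c.val)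
        else 0 := by
  ext c
  split_ifs with h0 h
  · apply vecMul_one_add_single k _ u c 1 (by omega) (by omega)
    · simp [Kk3mat, h0]
    · simp only [Kk3mat, Matrix.of_apply]
      rw [if_neg (by omega), if_neg (by omega), if_pos trivial]
    · intro i h1 h2
      simp only [Kk3mat, Matrix.of_apply]
      rw [if_neg (by omega), if_neg (by omega), if_neg h1]
  · apply vecMul_one_add_single k _ u c (k + 1 - c.val) (by omega) (by omega)
    · simp only [Kk3mat, Matrix.of_apply]
      rw [if_neg (by omega), if_pos (by omega)]
      congr 2
    · simp only [Kk3mat, Matrix.of_apply]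
      rw [if_neg (by omega), if_neg (by omega), if_pos trivial]
    · intro i h1 h2
      simp only [Kk3mat, Matrix.of_apply]
      rw [if_neg (by omega), if_neg (by omega), if_neg h1]
  · rw [add_zero]
    apply vecMul_of_column_eq_one
    · simp only [Kk3mat, Matrix.of_apply]
      rw [if_neg (by omega), if_neg (by omega), if_pos trivial]
    · intro i h1
      simp only [Kk3mat, Matrix.of_apply]
      rw [if_neg (by omega), if_neg (by omega), if_neg h1]

lemma vecMul_monodromy (k : ℕ) (hk : 3 ≤ k) (u : ℕ → ℂ) :
    (fun i : Fin k => u i) ᵥ* ((TFmat k)ᵀ * Kk3mat k * Kk2mat k) =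
      fun c : Fin k => monodromyOp k u c := by
  rw [← Matrix.vecMul_vecMul, ← Matrix.vecMul_vecMul, vecMul_TFmat_transpose k (by omega),
    vecMul_Kk3mat k hk (fun c => if c = 0 then u (k - 1) else -u (c - 1)),
    vecMul_Kk2mat k (fun c => (if c = 0 then u (k - 1) else -u (c - 1)) +
      if c = 0 then -(k : ℂ) * (if 1 = 0 then u (k - 1) else -u (1 - 1))
        else if k + 2 ≤ 2 * c then (k.choose (2 * (k + 1 - c) - 1) : ℂ) *
          (if k + 1 - c = 0 then u (k - 1) else -u (k + 1 - c - 1)) else 0)]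
  ext c
  have hc := c.2
  have e : k + 1 - c.val - 1 = k - c.val := by omega
  simp only [monodromyOp, e, one_ne_zero, if_false]
  split_ifs <;> first | omega | (simp; done) | (simp; ring)

lemma sub_one_sq_Kk2mat (k : ℕ) : (Kk2mat k - 1) * (Kk2mat k - 1) = 0 := by
  ext i j
  rw [Matrix.mul_apply]
  refine Finset.sum_eq_zero fun x _ => ?_
  simp only [Matrix.sub_apply, Kk2mat, Matrix.of_apply, Matrix.one_apply, Fin.ext_iff]
  split_ifs <;> first | omega | simp

lemma sub_one_sq_Kk3mat (k : ℕ) : (Kk3mat k - 1) * (Kk3mat k - 1) = 0 := by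
  ext i j
  rw [Matrix.mul_apply]
  refine Finset.sum_eq_zero fun x _ => ?_
  simp only [Matrix.sub_apply, Kk3mat, Matrix.of_apply, Matrix.one_apply, Fin.ext_iff]
  split_ifs <;> first | omega | simp

lemma isUnit_of_sub_one_sq {R : Type*} [Ring R] {a : R} (h : (a - 1) * (a - 1) = 0) :
    IsUnit a :=
  ⟨⟨a, 2 - a, by rw [show a * (2 - a) = 1 - (a - 1) * (a - 1) by noncomm_ring, h, sub_zero],
    by rw [show (2 - a) * a = 1 - (a - 1) * (a - 1) by noncomm_ring, h, sub_zero]⟩, rfl⟩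

lemma isUnit_monodromy (k : ℕ) :
    IsUnit ((TFmat k)ᵀ * Kk3mat k * Kk2mat k) := by
  refine IsUnit.mul (IsUnit.mul ?_ ?_) ?_
  · exact ⟨⟨_, _, mul_eq_one_comm.1 (TFmat_mul_transpose k), TFmat_mul_transpose k⟩, rfl⟩
  · exact isUnit_of_sub_one_sq (sub_one_sq_Kk3mat k)
  · exact isUnit_of_sub_one_sq (sub_one_sq_Kk2mat k)

lemma Tmonodromy_inv (k : ℕ) :
    (Tmonodromy k)⁻¹ = (TFmat k)ᵀ * Kk3mat k * Kk2mat k := by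
  rw [Tmonodromy, Matrix.inv_eq_right_inv (TFmat_mul_transpose k), Matrix.nonsing_inv_nonsing_inv]
  exact (Matrix.isUnit_iff_isUnit_det _).1 (isUnit_monodromy k)

/-- Tensoring with `O(1)` acts on the classes `stokesClass k c` by the matrix `T⁻¹`. -/
lemma eulerForm_twist_stokesClass (k : ℕ) (hk : 3 ≤ k) (y : ℤ →₀ ℂ) (c : ℕ) (hc : c < k) :
    eulerForm k y (twist 1 (stokesClass k c)) =
      monodromyOp k (fun l => eulerForm k y (stokesClass k l)) c := by
  have hlb : ∀ l, 2 * l ≤ k → stokesClass k l = (-1 : ℂ) ^ l • lineBundle ((k / 2 : ℕ) - l) := by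
    intro l hl
    rw [stokesClass, Nat.sub_eq_zero_of_le hl, koszul_zero]
  rw [monodromyOp]
  split_ifs with h0 h2 h1 h1
  · subst h0
    have hz := eulerForm_koszul_right k (by omega) ((k / 2 : ℕ) - (k - 1 : ℕ)) y
    obtain ⟨n, rfl⟩ : ∃ n, k = n + 2 := ⟨k - 2, by omega⟩
    rw [hlb 0 (by omega)]
    simp only [stokesClass]
    have e1 : 2 * (n + 2 - 1) - (n + 2) = n := by omega
    rw [e1]
    rw [koszul_succ, koszul_succ] at hz
    have e2 : (((n + 2) / 2 : ℕ) : ℤ) - ((n + 2 - 1 : ℕ) : ℤ) + ((n + 1 : ℕ) : ℤ) =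
        ((n + 2) / 2 : ℕ) - (0 : ℕ) := by omega
    have e3 : (((n + 2) / 2 : ℕ) : ℤ) - ((n + 2 - 1 : ℕ) : ℤ) + ((n + 1 + 1 : ℕ) : ℤ) =
        ((n + 2) / 2 : ℕ) - (0 : ℕ) + 1 := by omega
    have e4 : (n + 2).choose (n + 1) = n + 2 := by simp
    have e5 : (n + 2).choose (n + 1 + 1) = 1 := by simp
    have e6 : n + 2 - 1 = n + 1 := by omega
    rw [e2, e3, e4, e5] at hz
    rw [e6] at hz ⊢
    simp only [map_add, map_smul, smul_eq_mul, twist_lineBundle, pow_zero, one_smul] at hz ⊢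
    rcases neg_one_pow_eq_or ℂ n with h | h <;> simp only [pow_succ, h] at hz ⊢
    · linear_combination hz
    · linear_combination -hz
  · obtain ⟨r, t, rfl, rfl⟩ : ∃ r t, k = 2 * r + t + 4 ∧ c = r + t + 3 :=
      ⟨k - c - 1, 2 * c - k - 2, by omega, by omega⟩
    have e1 : 2 * r + t + 4 - (r + t + 3) = r + 1 := by omega
    have e2 : 2 * (2 * r + t + 4 + 1 - (r + t + 3)) - 1 = 2 * r + 3 := by omega
    have e3 : 2 * (r + t + 3) - (2 * r + t + 4) = t + 1 + 1 := by omega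
    have e4 : 2 * (r + t + 3 - 1) - (2 * r + t + 4) = t := by omega
    have e5 : (2 * r + t + 4).choose (2 * r + 3) = (2 * r + t + 4).choose (t + 1) :=
      Nat.choose_symm_of_eq_add (by omega)
    have e6 : (2 * r + t + 4).choose (2 * (r + 1)) = (2 * r + t + 4).choose (t + 1 + 1) :=
      Nat.choose_symm_of_eq_add (by omega)
    rw [e1, e2, e5, e6, hlb (r + 1) (by omega), hlb (r + 1 - 1) (by omega)]
    simp only [stokesClass, e3, e4]
    generalize (((2 * r + t + 4) / 2 : ℕ) : ℤ) = M
    have a1 : M - ((r + t + 3 : ℕ) : ℤ) + 1 = M - ((r + t + 3 - 1 : ℕ) : ℤ) := by omega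
    have a2 : M - ((r + t + 3 - 1 : ℕ) : ℤ) + ((t + 1 : ℕ) : ℤ) = M - ((r + 1 : ℕ) : ℤ) := by omega
    have a3 : M - ((r + t + 3 - 1 : ℕ) : ℤ) + ((t + 1 + 1 : ℕ) : ℤ) =
      M - ((r + 1 - 1 : ℕ) : ℤ) := by omega
    rw [map_smul, twist_koszul, a1, koszul_succ, koszul_succ, a2, a3]
    simp only [map_add, map_smul, smul_eq_mul, Nat.add_sub_cancel,
      show r + t + 3 - 1 = r + t + 2 by omega]
    have s1 : (-1 : ℂ) ^ t * (-1) ^ t = 1 := by rw [← mul_pow]; simp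
    simp only [pow_succ, pow_add]
    linear_combination (-(-1) ^ r * (((2 * r + t + 4).choose (t + 1) : ℂ) *
      eulerForm _ y (lineBundle (M - ((r + 1 : ℕ) : ℤ)))) * (-1)
      - (-1) ^ r * (((2 * r + t + 4).choose (t + 1 + 1) : ℂ) *
      eulerForm _ y (lineBundle (M - ((r : ℕ) : ℤ))))) * s1
  · omega
  · obtain ⟨r, rfl, rfl⟩ : ∃ r, k = 2 * r + 3 ∧ c = r + 2 := ⟨c - 2, by omega, by omega⟩
    have e1 : 2 * r + 3 - (r + 2) = r + 1 := by omega
    have e3 : 2 * (r + 2) - (2 * r + 3) = 0 + 1 := by omega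
    have e6 : (2 * r + 3).choose (2 * (r + 1)) = 2 * r + 3 := by
      rw [Nat.choose_symm_of_eq_add (b := 1) (by omega), Nat.choose_one_right]
    rw [e1, e6, hlb (r + 2 - 1) (by omega), hlb (r + 1 - 1) (by omega)]
    simp only [stokesClass, e3]
    generalize (((2 * r + 3) / 2 : ℕ) : ℤ) = M
    have a1 : M - ((r + 2 : ℕ) : ℤ) + 1 = M - ((r + 2 - 1 : ℕ) : ℤ) := by omega
    have a2 : M - ((r + 2 - 1 : ℕ) : ℤ) + ((0 + 1 : ℕ) : ℤ) = M - ((r + 1 - 1 : ℕ) : ℤ) := by omega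
    rw [map_smul, twist_koszul, a1, koszul_succ, a2, koszul_zero]
    simp only [map_add, map_smul, smul_eq_mul, Nat.add_sub_cancel, Nat.choose_one_right,
      show r + 2 - 1 = r + 1 by omega, Nat.zero_add]
    simp only [pow_succ]
    ring
  · obtain ⟨b, rfl⟩ : ∃ b, c = b + 1 := ⟨c - 1, by omega⟩
    have a1 : ((k / 2 : ℕ) : ℤ) - ((b + 1 : ℕ) : ℤ) + 1 = (k / 2 : ℕ) - b := by omega
    rw [hlb _ (by omega), hlb _ (by omega), map_smul, twist_lineBundle, a1]
    simp [pow_succ]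
/-- The functional `⟨y, ·⟩` on the classes `stokesClass k l`, as a row vector. -/
noncomputable def stokesRow (k : ℕ) (y : ℤ →₀ ℂ) : Fin k → ℂ :=
  fun l => eulerForm k y (stokesClass k l)

lemma stokesRow_vecMul (k : ℕ) (hk : 3 ≤ k) (y : ℤ →₀ ℂ) :
    stokesRow k y ᵥ* ((TFmat k)ᵀ * Kk3mat k * Kk2mat k) = stokesRow k (twist (-1) y) := by
  have h := vecMul_monodromy k hk fun l => eulerForm k y (stokesClass k l)
  refine h.trans (funext fun c => ?_)
  rw [← eulerForm_twist_stokesClass k hk y c c.2, stokesRow, ← eulerForm_twist k 1 (twist (-1) y)]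
  simp

lemma stokesRow_vecMul_pow (k : ℕ) (hk : 3 ≤ k) (y : ℤ →₀ ℂ) (n : ℕ) :
    stokesRow k y ᵥ* ((TFmat k)ᵀ * Kk3mat k * Kk2mat k) ^ n = stokesRow k (twist (-n) y) := by
  induction n with
  | zero => simp
  | succ n ih =>
    rw [pow_succ, ← Matrix.vecMul_vecMul, ih, stokesRow_vecMul k hk, twist_twist]
    congr 2
    push_cast; ring_nf

lemma stokesRow_eq_of_monodromyOp (k : ℕ) (hk : 3 ≤ k) (y : ℤ →₀ ℂ) (u : ℕ → ℂ)
    (h : ∀ c : Fin k, monodromyOp k u c = stokesRow k (twist (-1) y) c) (l : Fin k) :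
    stokesRow k y l = u l := by
  have h' := Matrix.vecMul_injective_of_isUnit (isUnit_monodromy k)
    ((stokesRow_vecMul k hk y).trans
      ((funext h).symm.trans (vecMul_monodromy k hk u).symm))
  exact congrFun h' l

lemma stokesRow_lineBundle (k : ℕ) (hk : 3 ≤ k) (a : ℕ) (ha : a ≤ k / 2) (l : Fin k) :
    stokesRow k (lineBundle ((k / 2 : ℕ) + a)) l =
      if a = 0 then (if l.val = 0 then 1 else 0)
      else if l.val + a = k then (-1) ^ (a + 1) else 0 := by
  induction a generalizing l with
  | zero =>
    have hl := l.2
    simp only [stokesRow, stokesClass, koszul, map_smul, map_sum, eulerForm_lineBundle, if_true]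
    split_ifs with h0
    · simp [h0, eulerChar_zero]
    · rw [Finset.sum_eq_zero, smul_zero]
      intro i hi
      have := Finset.mem_range.1 hi
      rw [eulerChar_eq_zero k _ (by omega) (by omega), smul_zero]
  | succ a ih =>
    refine stokesRow_eq_of_monodromyOp k hk _ (fun l => if a + 1 = 0 then (if l = 0 then 1 else 0)
      else if l + (a + 1) = k then (-1) ^ (a + 1 + 1) else 0) (fun c => ?_) l
    have hc := c.2
    have e : ((k / 2 : ℕ) : ℤ) + ((a + 1 : ℕ) : ℤ) + -1 = (k / 2 : ℕ) + a := by push_cast; ring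
    rw [twist_lineBundle, e, ih (by omega) c]
    simp only [monodromyOp]
    rcases Nat.eq_zero_or_pos a with rfl | hpos
    · split_ifs <;> first | contradiction | omega | simp
    · split_ifs <;> first | contradiction | omega | (simp; done) | simp [pow_succ]

lemma koszul_add_two (k : ℕ) (a : ℤ) (d : ℕ) : koszul k a (d + 2) = koszul k a d +
    ((-1) ^ (d + 1) * (k.choose (d + 1) : ℂ)) • lineBundle (a + (d + 1 : ℕ)) +
    ((-1) ^ d * (k.choose (d + 2) : ℂ)) • lineBundle (a + (d + 2 : ℕ)) := by
  rw [koszul_succ, koszul_succ, pow_succ _ (d + 1), pow_succ _ d, mul_assoc _ (-1 : ℂ) (-1),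
    neg_one_mul (-1 : ℂ), neg_neg, mul_one]

lemma stokesRow_add (k : ℕ) (x y : ℤ →₀ ℂ) (l : Fin k) :
    stokesRow k (x + y) l = stokesRow k x l + stokesRow k y l := by
  simp [stokesRow]

lemma stokesRow_smul (k : ℕ) (z : ℂ) (x : ℤ →₀ ℂ) (l : Fin k) :
    stokesRow k (z • x) l = z * stokesRow k x l := by
  simp [stokesRow]

lemma stokesRow_twist_neg_one (k : ℕ) (hk : 3 ≤ k) (y : ℤ →₀ ℂ) (u : ℕ → ℂ)
    (h : ∀ l : Fin k, stokesRow k y l = u l) (c : Fin k) :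
    stokesRow k (twist (-1) y) c = monodromyOp k u c := by
  rw [← stokesRow_vecMul k hk, funext h, vecMul_monodromy k hk]

lemma stokesRow_koszul_even (k m : ℕ) (hk : 3 ≤ k) (hm : k = 2 * m) (j : ℕ) (hj : j < m)
    (l : Fin k) :
    stokesRow k (koszul k (m - j) (2 * j)) l = if l.val = j then (-1) ^ j else 0 := by
  have hm' : k / 2 = m := by omega
  have hlb := stokesRow_lineBundle k hk
  rw [hm'] at hlb
  induction j generalizing l with
  | zero => simpa using hlb 0 (by omega) l
  | succ j ih =>
    have hl := l.2
    have e0 : koszul k (m - (j + 1 : ℕ)) (2 * j) = twist (-1) (koszul k (m - j) (2 * j)) := by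
      rw [twist_koszul]; congr 1; push_cast; ring
    have e1 : (m : ℤ) - ((j + 1 : ℕ) : ℤ) + ((2 * j + 1 : ℕ) : ℤ) = m + j := by push_cast; ring
    have e2 : (m : ℤ) - ((j + 1 : ℕ) : ℤ) + ((2 * j + 2 : ℕ) : ℤ) = m + (j + 1 : ℕ) := by
      push_cast; ring
    rw [Nat.mul_succ, koszul_add_two, e0, e1, e2, stokesRow_add, stokesRow_add, stokesRow_smul,
      stokesRow_smul, hlb _ (by omega), hlb _ (by omega),
      stokesRow_twist_neg_one k hk _ (fun l => if l = j then (-1) ^ j else 0) (ih (by omega))]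
    simp only [monodromyOp]
    have s1 : ((-1 : ℂ) ^ (2 * j)) = 1 := by simp
    rw [pow_succ _ (2 * j), s1]
    rcases Nat.eq_zero_or_pos l.val with h0 | h0
    · rcases Nat.eq_zero_or_pos j with hj0 | hj0 <;>
        simp (disch := omega) only [if_pos, if_neg, hj0] <;> simp
    · by_cases h1 : l.val = j + 1
      · simp (disch := omega) only [if_pos, if_neg, ite_self, mul_zero, add_zero]
        simp [pow_succ]
      by_cases h2 : l.val + j = k
      · rw [show 2 * (k + 1 - l.val) - 1 = 2 * j + 1 by omega]
        simp (disch := omega) only [if_pos, if_neg, mul_zero, add_zero]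
        ring
      by_cases h3 : l.val + (j + 1) = k
      · rw [show 2 * (k - l.val) = 2 * j + 2 by omega]
        simp (disch := omega) only [if_pos, if_neg, ite_self, mul_zero, add_zero]
        ring
      simp (disch := omega) only [if_pos, if_neg, ite_self, mul_zero, add_zero]
      simp

lemma stokesRow_koszul_odd (k m : ℕ) (hk : 3 ≤ k) (hm : k = 2 * m + 1) (j : ℕ) (hj : j < m)
    (l : Fin k) :
    stokesRow k (koszul k (m - (j + 1 : ℕ)) (2 * j + 1)) l =
      (if l.val = j + 1 then (-1) ^ (j + 1) else 0) +
        if l.val + (j + 1) = k then (-1) ^ (j + 1) * (k.choose (2 * (j + 1)) : ℂ) else 0 := by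
  have hm' : k / 2 = m := by omega
  have hlb := stokesRow_lineBundle k hk
  rw [hm'] at hlb
  induction j generalizing l with
  | zero =>
    have hl := l.2
    have e0 : lineBundle ((m : ℤ) - ((0 + 1 : ℕ) : ℤ)) = twist (-1) (lineBundle (m + (0 : ℕ))) := by
      rw [twist_lineBundle]; congr 1
    have e1 : (m : ℤ) - ((0 + 1 : ℕ) : ℤ) + ((0 + 1 : ℕ) : ℤ) = m + (0 : ℕ) := by push_cast; ring
    rw [Nat.mul_zero, koszul_succ, koszul_zero, e1, stokesRow_add, stokesRow_smul,
      hlb 0 (by omega), e0, stokesRow_twist_neg_one k hk _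
        (fun l => if 0 = 0 then (if l = 0 then 1 else 0)
          else if l + 0 = k then (-1) ^ (0 + 1) else 0) (hlb 0 (by omega))]
    simp only [monodromyOp]
    split_ifs <;> first | contradiction | omega | (simp; done) |
        (rw [show 2 * (k - l.val) = 2 by omega]; simp)
  | succ j ih =>
    have hl := l.2
    have e0 : koszul k (m - (j + 1 + 1 : ℕ)) (2 * j + 1) =
        twist (-1) (koszul k (m - (j + 1 : ℕ)) (2 * j + 1)) := by
      rw [twist_koszul]; congr 1; push_cast; ring
    have e1 : (m : ℤ) - ((j + 1 + 1 : ℕ) : ℤ) + ((2 * j + 1 + 1 : ℕ) : ℤ) = m + j := by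
      push_cast; ring
    have e2 : (m : ℤ) - ((j + 1 + 1 : ℕ) : ℤ) + ((2 * j + 1 + 2 : ℕ) : ℤ) = m + (j + 1 : ℕ) := by
      push_cast; ring
    rw [show 2 * (j + 1) + 1 = 2 * j + 1 + 2 by ring, koszul_add_two, e0, e1, e2, stokesRow_add,
      stokesRow_add, stokesRow_smul,
      stokesRow_smul, hlb _ (by omega), hlb _ (by omega),
      stokesRow_twist_neg_one k hk _ (fun l => (if l = j + 1 then (-1) ^ (j + 1) else 0) +
        if l + (j + 1) = k then (-1) ^ (j + 1) * (k.choose (2 * (j + 1)) : ℂ) else 0)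
        (ih (by omega))]
    simp only [monodromyOp]
    have s1 : ((-1 : ℂ) ^ (2 * j)) = 1 := by simp
    simp only [pow_succ _ (2 * j + 1), pow_succ _ (2 * j), s1]
    rcases Nat.eq_zero_or_pos l.val with h0 | h0
    · rcases Nat.eq_zero_or_pos j with hj0 | hj0 <;>
        simp (disch := omega) only [if_pos, if_neg, hj0] <;> simp
    by_cases h1 : l.val = j + 2
    · simp (disch := omega) only [if_pos, if_neg, ite_self, mul_zero, add_zero]
      ring
    by_cases h2 : l.val + j = k
    · rw [show 2 * (k + 1 - l.val) - 1 = 2 * j + 1 by omega]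
      simp (disch := omega) only [if_pos, if_neg, mul_zero, add_zero]
      ring_nf
    by_cases h3 : l.val + (j + 1) = k
    · rw [show 2 * (k + 1 - l.val) - 1 = 2 * j + 3 by omega]
      simp (disch := omega) only [if_pos, if_neg, ite_self, mul_zero, add_zero]
      ring
    by_cases h4 : l.val + (j + 2) = k
    · rw [show 2 * (k - l.val) = 2 * (j + 2) by omega]
      simp (disch := omega) only [if_pos, if_neg, ite_self, mul_zero, add_zero]
      ring
    simp (disch := omega) only [if_pos, if_neg, ite_self, mul_zero, add_zero]
    simp

lemma TFmat_pow_apply (k n : ℕ) (hn : n ≤ k) (i l : Fin k) :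
    (TFmat k ^ n) i l = if n ≤ i.val then (if l.val + n = i.val then (-1) ^ n else 0)
      else if l.val + n = k + i.val then (-1) ^ (n + 1) else 0 := by
  induction n generalizing i with
  | zero =>
    simp [Matrix.one_apply, Fin.ext_iff, eq_comm]
  | succ n ih =>
    have hi := i.2
    rw [pow_succ', TFmat_mul_apply, ih (by omega), ih (by omega)]
    by_cases h0 : i.val = 0
    · by_cases h1 : l.val + (n + 1) = k
      · simp (disch := omega) only [if_pos, if_neg]
        ring
      · simp (disch := omega) only [if_pos, if_neg]
    · rw [if_neg h0]
      by_cases h1 : n + 1 ≤ i.val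
      · by_cases h2 : l.val + (n + 1) = i.val
        · simp (disch := omega) only [if_pos]
          ring
        · simp (disch := omega) only [if_pos, if_neg, neg_zero]
      · by_cases h2 : l.val + (n + 1) = k + i.val
        · simp (disch := omega) only [if_pos, if_neg]
          ring
        · simp (disch := omega) only [if_pos, if_neg, neg_zero]

lemma neg_one_pow_mul_neg_one_pow {a b c : ℕ} (h : (a + b) % 2 = c % 2) :
    (-1 : ℂ) ^ a * (-1) ^ b = (-1) ^ c := by
  rw [← pow_add, neg_one_pow_eq_pow_mod_two, h, ← neg_one_pow_eq_pow_mod_two]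

lemma twist_stokesClass (k m : ℕ) (hm : k / 2 = m) (i : ℕ) :
    twist m (stokesClass k i) = (-1 : ℂ) ^ i • koszul k (m + m - i) (2 * i - k) := by
  rw [stokesClass, map_smul, twist_koszul, hm]
  congr 2
  ring

lemma stokesRow_twist_stokesClass_of_le (k m : ℕ) (hk : 3 ≤ k) (hm : k / 2 = m) (i : ℕ)
    (hi : i < m) (l : Fin k) : stokesRow k (twist m (stokesClass k i)) l =
      if l.val + m = k + i then (-1) ^ (m + 1) else 0 := by
  subst hm
  obtain ⟨a, ha⟩ := Nat.exists_eq_add_of_lt hi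
  rw [twist_stokesClass k _ rfl, stokesRow_smul, Nat.sub_eq_zero_of_le (by omega), koszul_zero,
    show ((k / 2 : ℕ) : ℤ) + (k / 2 : ℕ) - i = (k / 2 : ℕ) + (a + 1 : ℕ) by omega,
    stokesRow_lineBundle k hk _ (by omega), if_neg (Nat.succ_ne_zero a)]
  by_cases h : l.val + k / 2 = k + i
  · rw [if_pos (by omega), if_pos h]
    exact neg_one_pow_mul_neg_one_pow (by omega)
  · rw [if_neg (by omega), if_neg h, mul_zero]

lemma stokesRow_twist_stokesClass_even (k m : ℕ) (hk : 3 ≤ k) (hm : k = 2 * m) (i : Fin k) :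
    stokesRow k (twist m (stokesClass k i)) = (TFmat k ^ m) i := by
  ext l
  have hi := i.2
  rw [TFmat_pow_apply k m (by omega)]
  by_cases him : m ≤ i.val
  · obtain ⟨j, hj⟩ := Nat.exists_eq_add_of_le him
    rw [if_pos him, twist_stokesClass k m (by omega), stokesRow_smul,
      show (m : ℤ) + m - i.val = m - j by omega, show 2 * i.val - k = 2 * j by omega,
      stokesRow_koszul_even k m hk hm j (by omega)]
    by_cases h : l.val = j
    · rw [if_pos h, if_pos (by omega)]
      exact neg_one_pow_mul_neg_one_pow (by omega)
    · rw [if_neg h, if_neg (by omega), mul_zero]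
  · rw [if_neg him, stokesRow_twist_stokesClass_of_le k m hk (by omega) i (by omega)]

lemma stokesRow_twist_stokesClass_odd (k m : ℕ) (hk : 3 ≤ k) (hm : k = 2 * m + 1) (i : Fin k) :
    stokesRow k (twist m (stokesClass k i)) = (TFmat k ^ m * Kk2mat k) i := by
  have hi := i.2
  rw [Matrix.mul_apply_eq_vecMul, funext (TFmat_pow_apply k m (by omega) i),
    vecMul_Kk2mat k fun l => if m ≤ i.val then (if l + m = i.val then (-1) ^ m else 0)
      else if l + m = k + i.val then (-1) ^ (m + 1) else 0]
  ext l
  have hl := l.2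
  rcases lt_trichotomy i.val m with him | him | him
  · rw [stokesRow_twist_stokesClass_of_le k m hk (by omega) i (by omega)]
    by_cases h : k + 1 ≤ 2 * l.val
    · simp (disch := omega) only [if_pos, if_neg, mul_zero, add_zero]
    · simp (disch := omega) only [if_neg, add_zero]
  · have hlb := stokesRow_lineBundle k hk 0 (by omega) l
    rw [if_pos rfl, show k / 2 = m by omega] at hlb
    rw [twist_stokesClass k m (by omega), stokesRow_smul, Nat.sub_eq_zero_of_le (by omega),
      koszul_zero, show (m : ℤ) + m - i.val = m + (0 : ℕ) by omega, hlb, him]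
    by_cases h : l.val = 0
    · simp (disch := omega) only [if_pos, if_neg, mul_one, add_zero]
    · simp (disch := omega) only [if_neg, ite_self, mul_zero, add_zero]
  · obtain ⟨j, hj⟩ := Nat.exists_eq_add_of_lt him
    rw [twist_stokesClass k m (by omega), stokesRow_smul,
      show (m : ℤ) + m - i.val = m - (j + 1 : ℕ) by omega,
      show 2 * i.val - k = 2 * j + 1 by omega, stokesRow_koszul_odd k m hk hm j (by omega)]
    have hs : (-1 : ℂ) ^ i.val * (-1) ^ (j + 1) = (-1) ^ m :=
      neg_one_pow_mul_neg_one_pow (by omega)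
    by_cases h : l.val = j + 1
    · simp (disch := omega) only [if_pos, if_neg, add_zero, hs]
    by_cases h' : l.val + (j + 1) = k
    · rw [show 2 * (k - l.val) = 2 * (j + 1) by omega]
      simp (disch := omega) only [if_pos, if_neg, zero_add]
      rw [← hs]
      ring
    · simp (disch := omega) only [if_neg, ite_self, mul_zero, add_zero]

/-- The Stokes matrix is the Gram matrix of the Euler form on the classes `stokesClass k l`. -/
lemma Smat_apply (k : ℕ) (hk : 3 ≤ k) (i j : Fin k) :
    Smat k i j = eulerForm k (stokesClass k i) (stokesClass k j) := by
  have key : ∀ m : ℕ, ∀ N : Matrix (Fin k) (Fin k) ℂ,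
      stokesRow k (twist m (stokesClass k i)) = N i →
        (N * (Tmonodromy k)⁻¹ ^ m) i j = eulerForm k (stokesClass k i) (stokesClass k j) := by
    intro m N h
    rw [Matrix.mul_apply_eq_vecMul, ← h, Tmonodromy_inv, stokesRow_vecMul_pow k hk, twist_twist,
      add_neg_cancel, twist_zero, stokesRow]
  rw [Smat]
  split_ifs with h
  · exact key _ _ (stokesRow_twist_stokesClass_even k _ hk (by omega) i)
  · exact key _ _ (stokesRow_twist_stokesClass_odd k _ hk (by omega) i)

lemma realizes_Smat (k : ℕ) (hk : 3 ≤ k) (σ : Fin k → Fin k) (l : List (ℤ × ℕ))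
    (hl : ∀ a : Fin k,
      l[a.val]? = some (((k / 2 : ℕ) : ℤ) - ((σ a).val : ℤ), 2 * (σ a).val - k)) :
    Realizes k l ((Smat k).submatrix σ σ) :=
  ⟨fun a => stokesClass k (σ a), fun a b => Smat_apply k hk (σ a) (σ b), fun a =>
    ⟨_, hl a, (-1) ^ (σ a).val, neg_one_pow_eq_or ℂ _, rfl⟩⟩

lemma mutationSteps_even (k m : ℕ) (hm : k = 2 * m) :
    Relation.ReflTransGen (MutationStep k) (interlaced 0 0 m) (dualCollection m 0 k) := by
  have h1 := mutationSteps_interlaced k 0 0 m (by omega)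
  have h2 := mutationSteps_append [] (dualCollection 0 (0 + m) m)
    (mutationSteps_lineBundles k 1 m (by omega))
  have h3 := dualCollection_append (m : ℤ) 0 m m
  rw [sub_self, ← two_mul, ← hm] at h3
  rw [List.nil_append, List.nil_append, add_sub_cancel_left, h3] at h2
  exact h1.trans h2

lemma mutationSteps_odd (k m : ℕ) (hm : k = 2 * m + 1) :
    Relation.ReflTransGen (MutationStep k) ((0, 0) :: interlaced (-1) 1 m)
      (dualCollection m 0 k) := by
  have h1 := mutationSteps_append [(0, 0)] [] (mutationSteps_interlaced k (-1) 1 m (by omega))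
  have h2 := mutationSteps_append [] (dualCollection (-1) (1 + m) m)
    (mutationSteps_lineBundles k 0 (m + 1) (by omega))
  have h3 := dualCollection_append (m : ℤ) 0 (m + 1) m
  rw [show (m : ℤ) - ((m + 1 : ℕ) : ℤ) = -1 by omega, show 0 + (m + 1) = 1 + m by ring,
    show m + 1 + m = k by omega] at h3
  rw [show (0 : ℤ) + ((m + 1 : ℕ) : ℤ) - 1 = m by omega, List.nil_append, List.nil_append,
    h3] at h2
  simp only [List.append_nil, List.singleton_append] at h1
  exact h1.trans h2

/-- **Theorem 2 of the paper.** The Stokes matrix of the quantum cohomology of `CP^{k-1}`,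
put in upper triangular form `S_upper = P·S·P⁻¹` by the lexicographical permutation `σ`,
can be carried by finitely many positive braid moves and a sign change
`S' ↦ D·S'·D` (`D` diagonal with entries `±1`) to the Gram matrix `C_k`. -/
theorem stokes_matrix_of_CP_equals_gram_matrix
    (k : ℕ) (hk : 3 ≤ k) (σ : Equiv.Perm (Fin k))
    (hσ : ∀ a : Fin k, (σ a).val + 1 =
      if k % 2 = 0 then
        (if (a.val + 1) % 2 = 0 then k / 2 + 1 - (a.val + 1) / 2 else k / 2 + (a.val + 2) / 2)
      else
        (if (a.val + 1) % 2 = 0 then (k + 1) / 2 + (a.val + 1) / 2 else (k + 1) / 2 - a.val / 2)) :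
    ∃ S' : Matrix (Fin k) (Fin k) ℂ,
      Relation.ReflTransGen (posBraidMove k) ((Smat k).submatrix σ σ) S' ∧
      ∃ d : Fin k → ℂ, (∀ i, d i = 1 ∨ d i = -1) ∧
        Matrix.diagonal d * S' * Matrix.diagonal d = Ckmat k := by
  suffices H : ∃ l, Relation.ReflTransGen (MutationStep k) l
      (dualCollection ((k / 2 : ℕ) : ℤ) 0 k) ∧ l.length = k ∧ ∀ a : Fin k,
        l[a.val]? = some (((k / 2 : ℕ) : ℤ) - ((σ a).val : ℤ), 2 * (σ a).val - k) by
    obtain ⟨l, hsteps, hlen, hl⟩ := H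
    obtain ⟨S', hS', hr⟩ := (realizes_Smat k hk σ l hl).steps hlen hsteps
    exact ⟨S', hS', hr.exists_diagonal⟩
  obtain ⟨m, hm | hm⟩ := Nat.even_or_odd' k
  · have hm2 : k / 2 = m := by omega
    refine ⟨interlaced 0 0 m, ?_, by rw [interlaced_length, hm], fun a => ?_⟩
    · rw [hm2]
      exact mutationSteps_even k m hm
    · have ha := hσ a
      rw [if_pos (by omega)] at ha
      obtain ⟨j, hj | hj⟩ := Nat.even_or_odd' a.val
      · rw [if_neg (by omega)] at ha
        rw [hj, interlaced_getElem?_even _ _ _ _ (by omega), Option.some_inj, Prod.mk.injEq]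
        omega
      · rw [if_pos (by omega)] at ha
        rw [hj, interlaced_getElem?_odd _ _ _ _ (by omega), Option.some_inj, Prod.mk.injEq]
        omega
  · have hm2 : k / 2 = m := by omega
    refine ⟨(0, 0) :: interlaced (-1) 1 m, ?_, by simp [interlaced_length, hm], fun a => ?_⟩
    · rw [hm2]
      exact mutationSteps_odd k m hm
    · have ha := hσ a
      rw [if_neg (by omega)] at ha
      obtain ⟨j, hj | hj⟩ := Nat.even_or_odd' a.val
      · rw [if_neg (by omega)] at ha
        cases j with
        | zero =>
          rw [hj, Nat.mul_zero, List.getElem?_cons_zero, Option.some_inj, Prod.mk.injEq]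
          omega
        | succ j =>
          rw [hj, Nat.mul_succ, List.getElem?_cons_succ,
            interlaced_getElem?_odd _ _ _ _ (by omega), Option.some_inj, Prod.mk.injEq]
          omega
      · rw [if_pos (by omega)] at ha
        rw [hj, List.getElem?_cons_succ, interlaced_getElem?_even _ _ _ _ (by omega),
          Option.some_inj, Prod.mk.injEq]
        omega
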